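/- For every real ν ≥ 0, every real ε with 0 < ε ≤ 1, and every integer s ≥ 1, the positive zeros of the derivatives J′_ν and J′_{ν+ε} interlace: j′_{ν,s} < j′_{ν+ε,s} < j′_{ν,s+1}. -/

import Mathlib

open Real Filter

/-- Bessel function of the first kind of real order `ν`:
`J_ν(x) = Σ_{k=0}^∞ ((−1)^k / (k! · Γ(ν+k+1))) · (x/2)^{ν+2k}`. -/
noncomputable def besselJ (ν : ℝ) (x : ℝ) : ℝ :=
  ∑' k : ℕ, ((-1 : ℝ) ^ k / ((k.factorial : ℝ) * Real.Gamma (ν + k + 1))) *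
    (x / 2) ^ (ν + 2 * (k : ℝ))

/-- Bessel function of the second kind of real order `ν`, defined as the limit
`Y_ν(x) = lim_{μ→ν, μ ∉ ℤ} (J_μ(x)·cos(μπ) − J_{−μ}(x)) / sin(μπ)`. -/
noncomputable def besselY (ν : ℝ) (x : ℝ) : ℝ :=
  limUnder (nhdsWithin ν {μ : ℝ | ∀ n : ℤ, μ ≠ (n : ℝ)})
    fun μ => (besselJ μ x * Real.cos (μ * π) - besselJ (-μ) x) / Real.sin (μ * π)

/-- `z s`, for integers `s ≥ 1`, enumerates all the positive real zeros of `f`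
in strictly increasing order. -/
structure IsPosZeroSeq (f : ℝ → ℝ) (z : ℕ → ℝ) : Prop where
  pos : ∀ s, 1 ≤ s → 0 < z s
  mono : ∀ s t, 1 ≤ s → s < t → z s < z t
  isZero : ∀ s, 1 ≤ s → f (z s) = 0
  complete : ∀ x, 0 < x → f x = 0 → ∃ s, 1 ≤ s ∧ z s = x

/-- `z s`, for integers `s ≥ 1`, enumerates the zeros `j'_{ν,s}` of `J'_ν`
(increasingly), with the convention that `x = 0` is counted as the first zero
`j'_{0,1}` of `J'_0`. -/
def IsBesselJDerivZeroSeq (ν : ℝ) (z : ℕ → ℝ) : Prop :=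
  (ν = 0 → z 1 = 0 ∧ IsPosZeroSeq (deriv (besselJ 0)) fun s => z (s + 1)) ∧
  (ν ≠ 0 → IsPosZeroSeq (deriv (besselJ ν)) z)

open Set Topology

/-- The coefficients of the power series of `besselPhi ν`. -/
noncomputable def besselCoeff (ν : ℝ) (k : ℕ) : ℝ :=
  (-1 : ℝ) ^ k / ((k.factorial : ℝ) * Real.Gamma (ν + k + 1))

/-- The entire function `Φ_ν` with `J_ν(x) = (x/2)^ν Φ_ν(x²/4)`. -/
noncomputable def besselPhi (ν z : ℝ) : ℝ :=
  ∑' k : ℕ, besselCoeff ν k * z ^ k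

/-- The function `x J'_ν(x)` (for `x > 0`), written through `J_ν` and `J_{ν+1}`. -/
noncomputable def besselD (ν x : ℝ) : ℝ := ν * besselJ ν x - x * besselJ (ν + 1) x

/-- The Wronskian of `J_ν` and `J_μ` with respect to `x d/dx`. -/
noncomputable def besselW (ν μ x : ℝ) : ℝ :=
  besselJ ν x * besselD μ x - besselD ν x * besselJ μ x

section Series

variable {ν μ x : ℝ}

theorem Gamma_le_Gamma_add_nat (hν : 0 ≤ ν) (k : ℕ) :
    Real.Gamma (ν + 1) ≤ Real.Gamma (ν + k + 1) := by
  induction k with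
  | zero => simp
  | succ k ih =>
    have hk : (0 : ℝ) ≤ k := Nat.cast_nonneg k
    have h := Real.Gamma_add_one (s := ν + k + 1) (by positivity)
    have hpos : 0 < Real.Gamma (ν + k + 1) := Real.Gamma_pos_of_pos (by positivity)
    have : ν + ((k + 1 : ℕ) : ℝ) + 1 = ν + k + 1 + 1 := by push_cast; ring
    rw [this, h]
    nlinarith [mul_nonneg (add_nonneg hν hk) hpos.le]

theorem abs_besselCoeff_le (hν : 0 ≤ ν) (k : ℕ) :
    |besselCoeff ν k| ≤ (Real.Gamma (ν + 1))⁻¹ / k.factorial := by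
  have h0 : 0 < Real.Gamma (ν + 1) := Real.Gamma_pos_of_pos (by positivity)
  have h1 := Gamma_le_Gamma_add_nat hν k
  have hk : (0 : ℝ) < k.factorial := by positivity
  rw [besselCoeff, abs_div, abs_pow, abs_neg, abs_one, one_pow,
    abs_of_pos (mul_pos hk (h0.trans_le h1)), one_div]
  calc _ ≤ ((k.factorial : ℝ) * Real.Gamma (ν + 1))⁻¹ := by gcongr
    _ = _ := by rw [mul_inv, mul_comm, div_eq_mul_inv]

theorem summable_besselPhi (hν : 0 ≤ ν) (z : ℝ) :
    Summable fun k : ℕ => besselCoeff ν k * z ^ k := by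
  refine Summable.of_norm_bounded
    ((Real.summable_pow_div_factorial |z|).mul_left (Real.Gamma (ν + 1))⁻¹) fun k => ?_
  rw [norm_mul, norm_pow, Real.norm_eq_abs, Real.norm_eq_abs]
  calc _ ≤ (Real.Gamma (ν + 1))⁻¹ / k.factorial * |z| ^ k := by
        gcongr; exact abs_besselCoeff_le hν k
    _ = _ := by ring

theorem succ_mul_besselCoeff_succ (ν : ℝ) (k : ℕ) :
    ((k + 1 : ℕ) : ℝ) * besselCoeff ν (k + 1) = -besselCoeff (ν + 1) k := by
  have hk : ((k : ℝ) + 1) ≠ 0 := by positivity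
  have hf : (k.factorial : ℝ) ≠ 0 := by positivity
  have : ν + ((k + 1 : ℕ) : ℝ) + 1 = ν + 1 + k + 1 := by push_cast; ring
  rw [besselCoeff, besselCoeff, this, Nat.factorial_succ, pow_succ]
  push_cast
  by_cases hG : Real.Gamma (ν + 1 + k + 1) = 0
  · simp [hG]
  · field_simp

theorem hasDerivAt_besselPhi (hν : 0 ≤ ν) (z : ℝ) :
    HasDerivAt (besselPhi ν) (-besselPhi (ν + 1) z) z := by
  set R : ℝ := |z| + 1
  have hR : 0 < R := by positivity
  have hsucc : ∀ (k : ℕ) (y : ℝ), besselCoeff ν (k + 1) * (((k + 1 : ℕ) : ℝ) * y ^ (k + 1 - 1)) =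
      -(besselCoeff (ν + 1) k * y ^ k) := fun k y => by
    rw [Nat.add_sub_cancel, ← neg_mul, ← succ_mul_besselCoeff_succ]; ring
  have hu : Summable fun k : ℕ => |besselCoeff ν k| * ((k : ℝ) * R ^ (k - 1)) := by
    rw [← summable_nat_add_iff 1]
    refine (summable_besselPhi (by positivity : 0 ≤ ν + 1) R).norm.congr fun k => ?_
    rw [← norm_neg, ← hsucc, norm_mul, norm_mul, norm_pow, Real.norm_eq_abs, Real.norm_eq_abs,
      Real.norm_eq_abs, abs_of_pos hR, Nat.abs_cast]
  have hz : z ∈ Ioo (-R) R := by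
    rw [mem_Ioo, ← abs_lt]; simp [R]
  have key := hasDerivAt_tsum_of_isPreconnected (𝕜 := ℝ)
    (g := fun k y => besselCoeff ν k * y ^ k)
    (g' := fun k y => besselCoeff ν k * ((k : ℝ) * y ^ (k - 1))) hu isOpen_Ioo
    isPreconnected_Ioo (fun k y _ => (hasDerivAt_pow k y).const_mul _)
    (fun k y hy => by
      have hy' : |y| ≤ R := (abs_lt.2 hy).le
      rw [norm_mul, norm_mul, norm_pow, Real.norm_eq_abs, Real.norm_eq_abs, Real.norm_eq_abs,
        Nat.abs_cast]
      gcongr)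
    hz (summable_besselPhi hν z) hz
  have hsum : ∑' k : ℕ, besselCoeff ν k * ((k : ℝ) * z ^ (k - 1)) = -besselPhi (ν + 1) z := by
    have hs : Summable fun k : ℕ => besselCoeff ν k * ((k : ℝ) * z ^ (k - 1)) := by
      rw [← summable_nat_add_iff 1]
      exact ((summable_besselPhi (by positivity : 0 ≤ ν + 1) z).neg).congr fun k =>
        (hsucc k z).symm
    rw [hs.tsum_eq_zero_add]
    simp only [hsucc, tsum_neg, besselPhi]
    simp
  rw [hsum] at key
  exact key

theorem continuous_besselPhi (hν : 0 ≤ ν) : Continuous (besselPhi ν) :=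
  continuous_iff_continuousAt.2 fun z => (hasDerivAt_besselPhi hν z).continuousAt

theorem besselPhi_zero_pos (hν : 0 ≤ ν) : 0 < besselPhi ν 0 := by
  have : besselPhi ν 0 = besselCoeff ν 0 := by
    rw [besselPhi, tsum_eq_single 0 (fun k hk => by simp [hk])]; simp
  rw [this, besselCoeff]
  have : 0 < Real.Gamma (ν + 1) := Real.Gamma_pos_of_pos (by positivity)
  simpa using this

theorem besselPhi_recurrence (hν : 0 ≤ ν) (z : ℝ) :
    z * besselPhi (ν + 2) z = (ν + 1) * besselPhi (ν + 1) z - besselPhi ν z := by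
  have h0 := summable_besselPhi hν z
  have h1 := summable_besselPhi (by positivity : 0 ≤ ν + 1) z
  have hs := (h1.mul_left (ν + 1)).sub h0
  rw [besselPhi, besselPhi, besselPhi, ← tsum_mul_left, ← tsum_mul_left,
    ← (h1.mul_left (ν + 1)).tsum_sub h0, hs.tsum_eq_zero_add]
  have hzero : (ν + 1) * (besselCoeff (ν + 1) 0 * z ^ 0) - besselCoeff ν 0 * z ^ 0 = 0 := by
    have hG : Real.Gamma (ν + 1) ≠ 0 := (Real.Gamma_pos_of_pos (by positivity)).ne'
    simp only [besselCoeff, Nat.cast_zero, add_zero]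
    rw [Real.Gamma_add_one (by positivity)]
    have : ν + 1 ≠ 0 := by positivity
    field_simp
    ring
  rw [hzero, zero_add]
  congr 1
  ext k
  have hk : (0 : ℝ) ≤ k := Nat.cast_nonneg k
  have hG : Real.Gamma (ν + k + 2) ≠ 0 := (Real.Gamma_pos_of_pos (by positivity)).ne'
  have e1 : Real.Gamma (ν + 2 + k + 1) = (ν + k + 2) * Real.Gamma (ν + k + 2) := by
    rw [← Real.Gamma_add_one (by positivity)]; ring_nf
  have e2 : Real.Gamma (ν + 1 + ((k + 1 : ℕ) : ℝ) + 1) = (ν + k + 2) * Real.Gamma (ν + k + 2) := by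
    rw [← Real.Gamma_add_one (by positivity)]; push_cast; ring_nf
  have e3 : Real.Gamma (ν + ((k + 1 : ℕ) : ℝ) + 1) = Real.Gamma (ν + k + 2) := by
    push_cast; ring_nf
  have hf : (k.factorial : ℝ) ≠ 0 := by positivity
  have hk1 : (k : ℝ) + 1 ≠ 0 := by positivity
  have hk2 : ν + k + 2 ≠ 0 := by positivity
  rw [besselCoeff, besselCoeff, besselCoeff, e1, e2, e3, Nat.factorial_succ]
  push_cast
  field_simp
  ring

theorem besselJ_eq (ν : ℝ) (hx : 0 < x) :
    besselJ ν x = (x / 2) ^ ν * besselPhi ν (x ^ 2 / 4) := by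
  rw [besselJ, besselPhi, ← tsum_mul_left]
  congr 1
  ext k
  have : (x / 2) ^ (ν + 2 * (k : ℝ)) = (x / 2) ^ ν * (x ^ 2 / 4) ^ k := by
    rw [Real.rpow_add (by positivity), Real.rpow_mul (by positivity),
      Real.rpow_natCast, Real.rpow_two, div_pow]
    norm_num
  rw [this, besselCoeff]
  ring

theorem hasDerivAt_besselJ (hν : 0 ≤ ν) (hx : 0 < x) :
    HasDerivAt (besselJ ν) (besselD ν x / x) x := by
  have h1 : HasDerivAt (fun y : ℝ => (y / 2) ^ ν) ((1 / 2) * ν * (x / 2) ^ (ν - 1)) x :=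
    ((hasDerivAt_id x).div_const 2).rpow_const (Or.inl (by simp; positivity))
  have h2 : HasDerivAt (fun y : ℝ => y ^ 2 / 4) (x / 2) x := by
    refine ((hasDerivAt_pow 2 x).div_const 4).congr_deriv ?_
    norm_num
    ring
  have h3 := (hasDerivAt_besselPhi hν (x ^ 2 / 4)).comp x h2
  refine ((h1.mul h3).congr_of_eventuallyEq ?_).congr_deriv ?_
  · filter_upwards [lt_mem_nhds hx] with y hy
    exact besselJ_eq ν hy
  · rw [besselD, besselJ_eq ν hx, besselJ_eq _ hx, Real.rpow_sub_one (by positivity),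
      Real.rpow_add_one (by positivity)]
    simp only [Function.comp]
    field_simp
    ring

theorem besselD_add_one (hν : 0 ≤ ν) (hx : 0 < x) :
    besselD (ν + 1) x = x * besselJ ν x - (ν + 1) * besselJ (ν + 1) x := by
  have h := besselPhi_recurrence hν (x ^ 2 / 4)
  have e : ν + 1 + 1 = ν + 2 := by ring
  rw [besselD, e, besselJ_eq ν hx, besselJ_eq _ hx, besselJ_eq _ hx,
    Real.rpow_add_one (by positivity), Real.rpow_add (by positivity), Real.rpow_two]
  linear_combination (-x * (x / 2) ^ ν) * h

theorem hasDerivAt_besselD (hν : 0 ≤ ν) (hx : 0 < x) :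
    HasDerivAt (besselD ν) ((ν ^ 2 - x ^ 2) / x * besselJ ν x) x := by
  have h := ((hasDerivAt_besselJ hν hx).const_mul ν).sub
    ((hasDerivAt_id x).mul (hasDerivAt_besselJ (by positivity : 0 ≤ ν + 1) hx))
  refine h.congr_deriv ?_
  rw [besselD_add_one hν hx, besselD]
  simp only [id]
  field_simp
  ring

theorem hasDerivAt_besselW (hν : 0 ≤ ν) (hμ : 0 ≤ μ) (hx : 0 < x) :
    HasDerivAt (besselW ν μ) ((μ ^ 2 - ν ^ 2) / x * (besselJ ν x * besselJ μ x)) x := by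
  refine (((hasDerivAt_besselJ hν hx).mul (hasDerivAt_besselD hμ hx)).sub
    ((hasDerivAt_besselD hν hx).mul (hasDerivAt_besselJ hμ hx))).congr_deriv ?_
  field_simp
  ring

theorem eventually_besselJ_pos (hν : 0 ≤ ν) : ∀ᶠ x in 𝓝[>] (0 : ℝ), 0 < besselJ ν x := by
  have hc : ContinuousAt (fun x : ℝ => besselPhi ν (x ^ 2 / 4)) 0 := by
    have := continuous_besselPhi hν
    fun_prop
  have h0 : ∀ᶠ x in 𝓝 (0 : ℝ), 0 < besselPhi ν (x ^ 2 / 4) :=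
    hc.eventually_const_lt (by simpa using besselPhi_zero_pos hν)
  filter_upwards [h0.filter_mono nhdsWithin_le_nhds, self_mem_nhdsWithin] with x h hx
  have hx : 0 < x := hx
  rw [besselJ_eq ν hx]
  positivity

theorem eventually_besselD_pos (hν : 0 < ν) : ∀ᶠ x in 𝓝[>] (0 : ℝ), 0 < besselD ν x := by
  have hc : ContinuousAt (fun x : ℝ => ν * besselPhi ν (x ^ 2 / 4) -
      x ^ 2 / 2 * besselPhi (ν + 1) (x ^ 2 / 4)) 0 := by
    have := continuous_besselPhi hν.le
    have := continuous_besselPhi (by positivity : 0 ≤ ν + 1)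
    fun_prop
  have h0 := hc.eventually_const_lt (u := 0)
    (by simpa using mul_pos hν (besselPhi_zero_pos hν.le))
  filter_upwards [h0.filter_mono nhdsWithin_le_nhds, self_mem_nhdsWithin] with x h hx
  have hx : 0 < x := hx
  have hp : 0 < (x / 2) ^ ν := by positivity
  rw [besselD, besselJ_eq ν hx, besselJ_eq _ hx, Real.rpow_add_one (by positivity)]
  refine (mul_pos hp h).trans_eq ?_
  ring

theorem eventually_besselW_pos (hν : 0 ≤ ν) (hνμ : ν < μ) :
    ∀ᶠ x in 𝓝[>] (0 : ℝ), 0 < besselW ν μ x := by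
  have hμ : 0 ≤ μ := hν.trans hνμ.le
  have hc : ContinuousAt (fun x : ℝ =>
      (μ - ν) * (besselPhi ν (x ^ 2 / 4) * besselPhi μ (x ^ 2 / 4)) +
      x ^ 2 / 2 * (besselPhi (ν + 1) (x ^ 2 / 4) * besselPhi μ (x ^ 2 / 4) -
        besselPhi ν (x ^ 2 / 4) * besselPhi (μ + 1) (x ^ 2 / 4))) 0 := by
    have := continuous_besselPhi hν
    have := continuous_besselPhi hμ
    have := continuous_besselPhi (by positivity : 0 ≤ ν + 1)
    have := continuous_besselPhi (by positivity : 0 ≤ μ + 1)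
    fun_prop
  have h0 := hc.eventually_const_lt (u := 0) (by
    simpa using mul_pos (sub_pos.2 hνμ) (mul_pos (besselPhi_zero_pos hν) (besselPhi_zero_pos hμ)))
  filter_upwards [h0.filter_mono nhdsWithin_le_nhds, self_mem_nhdsWithin] with x h hx
  have hx : 0 < x := hx
  have hp : 0 < (x / 2) ^ ν * (x / 2) ^ μ := by positivity
  rw [besselW, besselD, besselD, besselJ_eq ν hx, besselJ_eq μ hx, besselJ_eq _ hx,
    besselJ_eq _ hx, Real.rpow_add_one (by positivity), Real.rpow_add_one (by positivity)]
  refine (mul_pos hp h).trans_eq ?_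
  ring

theorem deriv_besselJ (hν : 0 ≤ ν) (hx : 0 < x) : deriv (besselJ ν) x = besselD ν x / x :=
  (hasDerivAt_besselJ hν hx).deriv

end Series

section RealAnalysis

variable {f f' g : ℝ → ℝ} {a b x : ℝ}

theorem le_of_hasDerivAt_nonneg (hab : a < b) (hf : ∀ y ∈ Icc a b, HasDerivAt f (f' y) y)
    (hf' : ∀ y ∈ Ioo a b, 0 ≤ f' y) : f a ≤ f b := by
  obtain ⟨c, hc, h⟩ := exists_hasDerivAt_eq_slope f f' hab
    (fun y hy => (hf y hy).continuousAt.continuousWithinAt)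
    (fun y hy => hf y (Ioo_subset_Icc_self hy))
  have h2 := hf' c hc
  rw [h, le_div_iff₀ (sub_pos.2 hab)] at h2
  linarith

theorem exists_mem_Ioo_of_eventually_nhdsGT {p : ℝ → Prop} (h : ∀ᶠ y in 𝓝[>] a, p y)
    (hab : a < b) : ∃ y, a < y ∧ y < b ∧ p y := by
  obtain ⟨y, hy, hp⟩ := (Filter.Eventually.and (Ioo_mem_nhdsGT hab) h).exists
  exact ⟨y, hy.1, hy.2, hp⟩

theorem exists_mem_Ioo_of_eventually_nhdsLT {p : ℝ → Prop} (h : ∀ᶠ y in 𝓝[<] b, p y)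
    (hab : a < b) : ∃ y, a < y ∧ y < b ∧ p y := by
  obtain ⟨y, hy, hp⟩ := (Filter.Eventually.and (Ioo_mem_nhdsLT hab) h).exists
  exact ⟨y, hy.1, hy.2, hp⟩

/-- Continuous induction: a continuous function on `(0, ∞)` which is positive near `0` and cannot
lose its positivity for the first time at a point of `(0, b]` is positive on `(0, b]`. -/
theorem pos_of_pos_before (hc : ∀ x, 0 < x → ContinuousAt f x)
    (h0 : ∀ᶠ x in 𝓝[>] (0 : ℝ), 0 < f x)
    (step : ∀ x, 0 < x → x ≤ b → (∀ y, 0 < y → y < x → 0 < f y) → 0 < f x) :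
    ∀ x, 0 < x → x ≤ b → 0 < f x := by
  intro x hx hxb
  by_contra hneg
  obtain ⟨δ, hδ, hδ'⟩ := mem_nhdsGT_iff_exists_Ioo_subset.1 h0
  have hδ : 0 < δ := hδ
  set S := Icc (δ / 2) x ∩ {y | f y ≤ 0}
  have hSne : S.Nonempty := by
    refine ⟨x, ⟨?_, le_rfl⟩, not_lt.1 hneg⟩
    by_contra hlt
    exact hneg (hδ' ⟨hx, by linarith⟩)
  have hcont : ContinuousOn f (Icc (δ / 2) x) := fun y hy =>
    (hc y (by linarith [hy.1])).continuousWithinAt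
  have hS : IsCompact S := isCompact_Icc.of_isClosed_subset
    (hcont.preimage_isClosed_of_isClosed isClosed_Icc isClosed_Iic) inter_subset_left
  obtain ⟨m, hm, hmin⟩ := hS.exists_isLeast hSne
  refine absurd hm.2 (not_le.2 (step m (by linarith [hm.1.1]) (hm.1.2.trans hxb) ?_))
  intro y hy hym
  by_contra hneg'
  rcases lt_or_ge y δ with h | h
  · exact hneg' (hδ' ⟨hy, h⟩)
  · exact absurd (hmin ⟨⟨by linarith, hym.le.trans hm.1.2⟩, not_lt.1 hneg'⟩) (not_le.2 hym)

theorem nonneg_of_pos_before (hx : 0 < x) (hc : ContinuousAt f x)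
    (h : ∀ y, 0 < y → y < x → 0 < f y) : 0 ≤ f x := by
  refine ge_of_tendsto (hc.tendsto.mono_left nhdsWithin_le_nhds : Tendsto f (𝓝[<] x) (𝓝 (f x))) ?_
  filter_upwards [Ioo_mem_nhdsLT hx] with y hy
  exact (h y hy.1 hy.2).le

theorem eventually_mul_pos_of_hasDerivAt {c d : ℝ} (hf : HasDerivAt f c x) (hg : HasDerivAt g d x)
    (hfx : f x = 0) (hgx : g x = 0) (hcd : 0 < c * d) : ∀ᶠ y in 𝓝[≠] x, 0 < f y * g y := by
  have h := (hasDerivAt_iff_tendsto_slope.1 hf).mul (hasDerivAt_iff_tendsto_slope.1 hg)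
  filter_upwards [h.eventually_const_lt hcd, self_mem_nhdsWithin] with y hy hyx
  have hyx : y - x ≠ 0 := sub_ne_zero.2 hyx
  rw [slope_def_field, slope_def_field, hfx, hgx, sub_zero, sub_zero, div_mul_div_comm,
    div_pos_iff_of_pos_right (mul_self_pos.2 hyx)] at hy
  exact hy

theorem exists_zero_of_mul_neg (hab : a < b) (hc : ∀ y ∈ Icc a b, ContinuousAt f y)
    (h : f a * f b < 0) : ∃ c, a < c ∧ c < b ∧ f c = 0 := by
  have hco : ContinuousOn f (Icc a b) := fun y hy => (hc y hy).continuousWithinAt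
  rcases mul_neg_iff.1 h with ⟨h1, h2⟩ | ⟨h1, h2⟩
  · obtain ⟨c, hc, hc'⟩ := intermediate_value_Ioo' hab.le hco ⟨h2, h1⟩
    exact ⟨c, hc.1, hc.2, hc'⟩
  · obtain ⟨c, hc, hc'⟩ := intermediate_value_Ioo hab.le hco ⟨h1, h2⟩
    exact ⟨c, hc.1, hc.2, hc'⟩

/-- Near a zero with nonzero derivative `c`, on the left, `f` has the sign of `-c`. -/
theorem eventually_nhdsLT_mul_neg {c : ℝ} (hf : HasDerivAt f c x) (hfx : f x = 0) (hc : c ≠ 0) :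
    ∀ᶠ y in 𝓝[<] x, f y * c < 0 := by
  have h := (eventually_mul_pos_of_hasDerivAt hf ((hasDerivAt_id x).sub_const x |>.const_mul c) hfx
    (by simp) (by simpa using mul_self_pos.2 hc)).filter_mono (nhdsLT_le_nhdsNE x)
  filter_upwards [h, self_mem_nhdsWithin] with y hy hyx
  have hyx : y < x := hyx
  simp only [id] at hy
  by_contra hneg
  nlinarith [mul_nonneg (not_lt.1 hneg) (sub_pos.2 hyx).le]

/-- Near a zero with nonzero derivative `c`, on the right, `f` has the sign of `c`. -/
theorem eventually_nhdsGT_mul_pos {c : ℝ} (hf : HasDerivAt f c x) (hfx : f x = 0) (hc : c ≠ 0) :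
    ∀ᶠ y in 𝓝[>] x, 0 < f y * c := by
  have h := (eventually_mul_pos_of_hasDerivAt hf ((hasDerivAt_id x).sub_const x |>.const_mul c) hfx
    (by simp) (by simpa using mul_self_pos.2 hc)).filter_mono (nhdsGT_le_nhdsNE x)
  filter_upwards [h, self_mem_nhdsWithin] with y hy hyx
  have hyx : x < y := hyx
  simp only [id] at hy
  by_contra hneg
  nlinarith [mul_nonneg (neg_nonneg.2 (not_lt.1 hneg)) (sub_pos.2 hyx).le]

theorem exists_zero_of_deriv_mul_pos {c d : ℝ} (hab : a < b)
    (hc : ∀ y ∈ Icc a b, ContinuousAt f y) (hfa : HasDerivAt f c a) (hfb : HasDerivAt f d b)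
    (ha : f a = 0) (hb : f b = 0) (hcd : 0 < c * d) : ∃ y, a < y ∧ y < b ∧ f y = 0 := by
  obtain ⟨m, ham, hmb, hm⟩ := exists_mem_Ioo_of_eventually_nhdsGT
    (eventually_nhdsGT_mul_pos hfa ha (left_ne_zero_of_mul hcd.ne')) hab
  obtain ⟨n, hmn, hnb, hn⟩ := exists_mem_Ioo_of_eventually_nhdsLT
    (eventually_nhdsLT_mul_neg hfb hb (right_ne_zero_of_mul hcd.ne')) hmb
  have hmul : f m * f n < 0 := by
    have : f m * f n * (c * d) < 0 := by linarith [mul_neg_of_pos_of_neg hm hn]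
    exact (neg_iff_pos_of_mul_neg this).2 hcd
  obtain ⟨y, hy1, hy2, hy⟩ := exists_zero_of_mul_neg hmn
    (fun y hy => hc y ⟨ham.le.trans hy.1, hy.2.trans hnb.le⟩) hmul
  exact ⟨y, ham.trans hy1, hy2.trans hnb, hy⟩

end RealAnalysis

section Wronskian

variable {ν μ x : ℝ}

theorem continuousAt_besselJ (hν : 0 ≤ ν) (hx : 0 < x) : ContinuousAt (besselJ ν) x :=
  (hasDerivAt_besselJ hν hx).continuousAt

theorem continuousAt_besselD (hν : 0 ≤ ν) (hx : 0 < x) : ContinuousAt (besselD ν) x :=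
  (hasDerivAt_besselD hν hx).continuousAt

theorem continuousAt_besselW (hν : 0 ≤ ν) (hμ : 0 ≤ μ) (hx : 0 < x) :
    ContinuousAt (besselW ν μ) x :=
  (hasDerivAt_besselW hν hμ hx).continuousAt

theorem besselD_pos_of_le (hν : 0 < ν) (hx : 0 < x) (hxν : x ≤ ν) : 0 < besselD ν x := by
  have key : ∀ x, 0 < x → x ≤ ν → 0 < min (besselJ ν x) (besselD ν x) := by
    refine pos_of_pos_before (fun x hx =>
      (continuousAt_besselJ hν.le hx).min (continuousAt_besselD hν.le hx)) ?_ ?_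
    · filter_upwards [eventually_besselJ_pos hν.le, eventually_besselD_pos hν] with x h1 h2
      exact lt_min h1 h2
    · intro x hx hxν h
      have hm := lt_min_iff.1 (h (x / 2) (by positivity) (by linarith))
      have hpos : ∀ y ∈ Ioo (x / 2) x, 0 < y ∧ 0 < besselJ ν y ∧ 0 < besselD ν y :=
        fun y hy => ⟨by linarith [hy.1], lt_min_iff.1 (h y (by linarith [hy.1]) hy.2)⟩
      have h1 := le_of_hasDerivAt_nonneg (by linarith : x / 2 < x)
        (fun y hy => hasDerivAt_besselJ hν.le (by linarith [hy.1] : 0 < y))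
        (fun y hy => by
          obtain ⟨h1, h2, h3⟩ := hpos y hy
          positivity)
      have h2 := le_of_hasDerivAt_nonneg (by linarith : x / 2 < x)
        (fun y hy => hasDerivAt_besselD hν.le (by linarith [hy.1] : 0 < y))
        (fun y hy => by
          obtain ⟨h1, h2, h3⟩ := hpos y hy
          have : 0 ≤ ν ^ 2 - y ^ 2 := by nlinarith [hy.2]
          positivity)
      exact lt_min (hm.1.trans_le h1) (hm.2.trans_le h2)
  exact (lt_min_iff.1 (key x hx hxν)).2

theorem lt_of_besselD_eq_zero (hν : 0 ≤ ν) (hx : 0 < x) (h : besselD ν x = 0) : ν < x := by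
  rcases hν.eq_or_lt with rfl | hν
  · exact hx
  · by_contra hle
    exact (besselD_pos_of_le hν hx (not_lt.1 hle)).ne' h

theorem besselJ_sq_add_sq_pos (hν : 0 ≤ ν) (hx : 0 < x) :
    0 < besselJ ν x ^ 2 + besselJ (ν + 1) x ^ 2 := by
  obtain ⟨y, hy, hyx, hJ⟩ := exists_mem_Ioo_of_eventually_nhdsGT (eventually_besselJ_pos hν) hx
  have hν1 : 0 ≤ ν + 1 := by positivity
  have hmono := le_of_hasDerivAt_nonneg
    (f := fun z => z ^ (2 * ν + 2) * (besselJ ν z ^ 2 + besselJ (ν + 1) z ^ 2))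
    (f' := fun z => z ^ (2 * ν + 1) * ((4 * ν + 2) * besselJ ν z ^ 2)) hyx
    (fun z hz => by
      have hz : 0 < z := hy.trans_le hz.1
      refine ((Real.hasDerivAt_rpow_const (Or.inl hz.ne')).mul
        (((hasDerivAt_besselJ hν hz).pow 2).add ((hasDerivAt_besselJ hν1 hz).pow 2))).congr_deriv ?_
      have e : (2 * ν + 2 : ℝ) = 2 * ν + 1 + 1 := by ring
      rw [besselD_add_one hν hz, besselD, e, Real.rpow_add_one hz.ne', add_sub_cancel_right]
      simp only [Pi.add_apply, Pi.pow_apply]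
      field_simp
      ring)
    (fun z hz => by
      have hz : 0 < z := hy.trans hz.1
      positivity)
  have hpos : 0 < y ^ (2 * ν + 2) * (besselJ ν y ^ 2 + besselJ (ν + 1) y ^ 2) := by positivity
  exact pos_of_mul_pos_right (hpos.trans_le hmono) (by positivity)

theorem besselD_ne_zero_of_besselJ_eq_zero (hν : 0 ≤ ν) (hx : 0 < x) (h : besselJ ν x = 0) :
    besselD ν x ≠ 0 := by
  have := besselJ_sq_add_sq_pos hν hx
  intro h'
  rw [besselD, h] at h'
  have : besselJ (ν + 1) x = 0 := by simpa [hx.ne'] using h'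
  simp_all

/-- Sturm's argument: the Wronskian cannot vanish for the first time at a point to the left of
which the two functions have the same sign. -/
theorem besselW_pos_of_pos_before (hν : 0 ≤ ν) (hνμ : ν < μ) (hx : 0 < x)
    (h : ∀ y, 0 < y → y < x → 0 < besselW ν μ y)
    (hs : ∀ᶠ y in 𝓝[<] x, 0 ≤ besselJ ν y * besselJ μ y) : 0 < besselW ν μ x := by
  obtain ⟨l, hl, hl'⟩ := mem_nhdsLT_iff_exists_Ioo_subset.1 hs
  have hl : l < x := hl
  obtain ⟨m, hm, hmx⟩ := exists_between (max_lt hl hx)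
  obtain ⟨hlm, hm0⟩ := max_lt_iff.1 hm
  refine (h m hm0 hmx).trans_le (le_of_hasDerivAt_nonneg hmx
    (fun y hy => hasDerivAt_besselW hν (hν.trans hνμ.le) (hm0.trans_le hy.1)) fun y hy => ?_)
  have h1 : 0 ≤ besselJ ν y * besselJ μ y := hl' ⟨hlm.trans hy.1, hy.2⟩
  have h2 : 0 < y := hm0.trans hy.1
  have h3 : 0 ≤ μ ^ 2 - ν ^ 2 := by nlinarith
  positivity

theorem besselW_add_one_pos (hν : 0 ≤ ν) (hx : 0 < x) : 0 < besselW ν (ν + 1) x := by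
  have hν1 : 0 ≤ ν + 1 := by positivity
  refine pos_of_pos_before (b := x) (fun y hy => continuousAt_besselW hν hν1 hy)
    (eventually_besselW_pos hν (lt_add_one ν)) (fun y hy _ h => ?_) x hx le_rfl
  rcases le_or_gt (besselJ ν y * besselJ (ν + 1) y) 0 with hs | hs
  · have hsq := mul_pos hy (besselJ_sq_add_sq_pos hν hy)
    rw [besselW, besselD_add_one hν hy, besselD]
    nlinarith [mul_nonneg (by positivity : 0 ≤ 2 * ν + 1) (neg_nonneg.2 hs)]
  · refine besselW_pos_of_pos_before hν (lt_add_one ν) hy h ?_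
    filter_upwards [(((continuousAt_besselJ hν hy).mul
      (continuousAt_besselJ hν1 hy)).eventually_const_lt hs).filter_mono nhdsWithin_le_nhds]
      with z hz
    exact hz.le

theorem eventually_besselJ_mul_nonneg {β γ : ℝ} (hν : 0 ≤ ν) (hμ : 0 ≤ μ) (hx : 0 < x)
    (hβ : 0 ≤ β) (hγ : 0 < γ) (hJ : β * besselJ ν x = γ * besselJ μ x)
    (hD : β * besselD ν x = γ * besselD μ x) :
    ∀ᶠ y in 𝓝[<] x, 0 ≤ besselJ ν y * besselJ μ y := by
  have sign : ∀ {p q : ℝ}, β * p = γ * q → q ≠ 0 → 0 < p * q := fun {p q} h hq => by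
    have : 0 < β * (p * q) := by
      rw [← mul_assoc, h, mul_assoc]
      exact mul_pos hγ (mul_self_pos.2 hq)
    exact pos_of_mul_pos_right this hβ
  by_cases h0 : besselJ μ x = 0
  · have hD0 := sign hD (besselD_ne_zero_of_besselJ_eq_zero hμ hx h0)
    have hβ0 : β ≠ 0 := by
      rintro rfl
      rw [zero_mul, eq_comm, mul_eq_zero] at hD
      exact hD.elim hγ.ne' (besselD_ne_zero_of_besselJ_eq_zero hμ hx h0)
    have h0' : besselJ ν x = 0 := by simpa [h0, hβ0] using hJ
    have h := eventually_mul_pos_of_hasDerivAt (hasDerivAt_besselJ hν hx)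
      (hasDerivAt_besselJ hμ hx) h0' h0 (by rw [div_mul_div_comm]; positivity)
    filter_upwards [h.filter_mono (nhdsLT_le_nhdsNE x)] with y hy
    exact hy.le
  · filter_upwards [(((continuousAt_besselJ hν hx).mul
      (continuousAt_besselJ hμ hx)).eventually_const_lt (sign hJ h0)).filter_mono
      nhdsWithin_le_nhds] with z hz
    exact hz.le

theorem besselW_pos (hν : 0 ≤ ν) (hνμ : ν < μ) (hμ : μ ≤ ν + 1) (hx : 0 < x) :
    0 < besselW ν μ x := by
  rcases hμ.eq_or_lt with rfl | hμ
  · exact besselW_add_one_pos hν hx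
  have hμ0 : 0 ≤ μ := hν.trans hνμ.le
  have hν1 : 0 ≤ ν + 1 := by positivity
  have key := pos_of_pos_before (b := x)
    (f := fun y => min (besselW ν μ y) (besselW μ (ν + 1) y))
    (fun y hy => (continuousAt_besselW hν hμ0 hy).min (continuousAt_besselW hμ0 hν1 hy))
    (by
      filter_upwards [eventually_besselW_pos hν hνμ, eventually_besselW_pos hμ0 hμ] with y h1 h2
      exact lt_min h1 h2)
    (fun y hy _ h => by
      have h1 : ∀ z, 0 < z → z < y → 0 < besselW ν μ z :=
        fun z hz hzy => (lt_min_iff.1 (h z hz hzy)).1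
      have h2 : ∀ z, 0 < z → z < y → 0 < besselW μ (ν + 1) z :=
        fun z hz hzy => (lt_min_iff.1 (h z hz hzy)).2
      have hW := besselW_add_one_pos hν hy
      have h1' := nonneg_of_pos_before hy (continuousAt_besselW hν hμ0 hy) h1
      have h2' := nonneg_of_pos_before hy (continuousAt_besselW hμ0 hν1 hy) h2
      have pluckerJ : besselW ν μ y * besselJ (ν + 1) y + besselW μ (ν + 1) y * besselJ ν y =
          besselW ν (ν + 1) y * besselJ μ y := by
        simp only [besselW]; ring
      have pluckerD : besselW ν μ y * besselD (ν + 1) y + besselW μ (ν + 1) y * besselD ν y =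
          besselW ν (ν + 1) y * besselD μ y := by
        simp only [besselW]; ring
      refine lt_min ?_ ?_
      · by_contra hneg
        have h0 : besselW ν μ y = 0 := le_antisymm (not_lt.1 hneg) h1'
        rw [h0, zero_mul, zero_add] at pluckerJ pluckerD
        exact hneg (besselW_pos_of_pos_before hν hνμ hy h1
          (eventually_besselJ_mul_nonneg hν hμ0 hy h2' hW pluckerJ pluckerD))
      · by_contra hneg
        have h0 : besselW μ (ν + 1) y = 0 := le_antisymm (not_lt.1 hneg) h2'
        rw [h0, zero_mul, add_zero] at pluckerJ pluckerD
        refine hneg (besselW_pos_of_pos_before hμ0 hμ hy h2 ?_)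
        simpa only [mul_comm] using
          eventually_besselJ_mul_nonneg hν1 hμ0 hy h1' hW pluckerJ pluckerD)
    x hx le_rfl
  exact (lt_min_iff.1 key).1

end Wronskian

section Zeros

variable {ν μ a b x : ℝ} {f : ℝ → ℝ} {z : ℕ → ℝ}

theorem IsPosZeroSeq.congr {g : ℝ → ℝ} (hz : IsPosZeroSeq f z)
    (h : ∀ x, 0 < x → (f x = 0 ↔ g x = 0)) : IsPosZeroSeq g z where
  pos := hz.pos
  mono := hz.mono
  isZero s hs := (h _ (hz.pos s hs)).1 (hz.isZero s hs)
  complete x hx hgx := hz.complete x hx ((h x hx).2 hgx)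

theorem IsPosZeroSeq.monotone (hz : IsPosZeroSeq f z) {s t : ℕ} (hs : 1 ≤ s) (hst : s ≤ t) :
    z s ≤ z t := by
  rcases hst.eq_or_lt with rfl | h
  · exact le_rfl
  · exact (hz.mono s t hs h).le

theorem IsPosZeroSeq.ne_zero_of_lt_first (hz : IsPosZeroSeq f z) (hx : 0 < x) (h : x < z 1) :
    f x ≠ 0 := by
  intro hfx
  obtain ⟨t, ht, rfl⟩ := hz.complete x hx hfx
  exact absurd (hz.monotone le_rfl ht) (not_le.2 h)

theorem IsPosZeroSeq.ne_zero_between (hz : IsPosZeroSeq f z) {s : ℕ} (hs : 1 ≤ s)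
    (h : z s < x) (h' : x < z (s + 1)) : f x ≠ 0 := by
  intro hfx
  obtain ⟨t, ht, rfl⟩ := hz.complete x ((hz.pos s hs).trans h) hfx
  rcases le_or_gt t s with hts | hts
  · exact absurd (hz.monotone ht hts) (not_le.2 h)
  · exact absurd (hz.monotone (by omega) hts) (not_le.2 h')

theorem deriv_besselJ_eq_zero_iff (hν : 0 ≤ ν) (hx : 0 < x) :
    deriv (besselJ ν) x = 0 ↔ besselD ν x = 0 := by
  rw [deriv_besselJ hν hx, div_eq_zero_iff, or_iff_left hx.ne']

theorem isPosZeroSeq_besselD (hν : 0 ≤ ν) (hz : IsPosZeroSeq (deriv (besselJ ν)) z) :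
    IsPosZeroSeq (besselD ν) z :=
  hz.congr fun _ hx => deriv_besselJ_eq_zero_iff hν hx

theorem besselJ_ne_zero_of_besselD_eq_zero (hν : 0 ≤ ν) (hx : 0 < x) (h : besselD ν x = 0) :
    besselJ ν x ≠ 0 :=
  fun h' => besselD_ne_zero_of_besselJ_eq_zero hν hx h' h

theorem besselD_deriv_factor_neg (hν : 0 ≤ ν) (hx : 0 < x) (h : besselD ν x = 0) :
    (ν ^ 2 - x ^ 2) / x < 0 :=
  div_neg_of_neg_of_pos (by nlinarith [lt_of_besselD_eq_zero hν hx h]) hx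

/-- `J_ν` changes sign between consecutive critical points. -/
theorem besselJ_mul_neg_of_consecutive (hν : 0 ≤ ν) (ha : 0 < a) (hab : a < b)
    (hDa : besselD ν a = 0) (hDb : besselD ν b = 0)
    (hD : ∀ x, a < x → x < b → besselD ν x ≠ 0) : besselJ ν a * besselJ ν b < 0 := by
  have hb := ha.trans hab
  refine lt_of_le_of_ne (not_lt.1 fun hpos => ?_) (mul_ne_zero
    (besselJ_ne_zero_of_besselD_eq_zero hν ha hDa) (besselJ_ne_zero_of_besselD_eq_zero hν hb hDb))
  obtain ⟨y, hay, hyb, hy⟩ := exists_zero_of_deriv_mul_pos hab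
    (fun y hy => continuousAt_besselD hν (ha.trans_le hy.1))
    (hasDerivAt_besselD hν ha) (hasDerivAt_besselD hν hb) hDa hDb (by
      have := mul_pos (mul_pos_of_neg_of_neg (besselD_deriv_factor_neg hν ha hDa)
        (besselD_deriv_factor_neg hν hb hDb)) hpos
      linarith)
  exact hD y hay hyb hy

theorem exists_besselD_right_zero_between (hν : 0 ≤ ν) (hνμ : ν < μ) (hμ : μ ≤ ν + 1) (ha : 0 < a)
    (hab : a < b) (hDa : besselD ν a = 0) (hDb : besselD ν b = 0)
    (hD : ∀ x, a < x → x < b → besselD ν x ≠ 0) : ∃ c, a < c ∧ c < b ∧ besselD μ c = 0 := by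
  have hWa := besselW_pos hν hνμ hμ ha
  have hWb := besselW_pos hν hνμ hμ (ha.trans hab)
  have hJ := besselJ_mul_neg_of_consecutive hν ha hab hDa hDb hD
  rw [besselW, hDa, zero_mul, sub_zero] at hWa
  rw [besselW, hDb, zero_mul, sub_zero] at hWb
  refine exists_zero_of_mul_neg hab
    (fun y hy => continuousAt_besselD (hν.trans hνμ.le) (ha.trans_le hy.1)) ?_
  have := mul_pos hWa hWb
  exact (neg_iff_neg_of_mul_pos (this.trans_eq (by ring))).1 hJ

theorem exists_besselD_left_zero_between (hν : 0 ≤ ν) (hνμ : ν < μ) (hμ : μ ≤ ν + 1) (ha : 0 < a)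
    (hab : a < b) (hDa : besselD μ a = 0) (hDb : besselD μ b = 0)
    (hD : ∀ x, a < x → x < b → besselD μ x ≠ 0) : ∃ c, a < c ∧ c < b ∧ besselD ν c = 0 := by
  have hWa := besselW_pos hν hνμ hμ ha
  have hWb := besselW_pos hν hνμ hμ (ha.trans hab)
  have hJ := besselJ_mul_neg_of_consecutive (hν.trans hνμ.le) ha hab hDa hDb hD
  rw [besselW, hDa, mul_zero, zero_sub] at hWa
  rw [besselW, hDb, mul_zero, zero_sub] at hWb
  refine exists_zero_of_mul_neg hab
    (fun y hy => continuousAt_besselD hν (ha.trans_le hy.1)) ?_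
  have := mul_pos hWa hWb
  exact (neg_iff_neg_of_mul_pos (this.trans_eq (by ring))).1 hJ

theorem besselJ_pos_of_first_zero (hν : 0 < ν) (hb : 0 < b) (hDb : besselD ν b = 0)
    (hD : ∀ x, 0 < x → x < b → besselD ν x ≠ 0) : 0 < besselJ ν b := by
  have hne := besselJ_ne_zero_of_besselD_eq_zero hν.le hb hDb
  by_contra hneg
  have hlt : besselJ ν b < 0 := lt_of_le_of_ne (not_lt.1 hneg) hne
  have hder := mul_pos_of_neg_of_neg (besselD_deriv_factor_neg hν.le hb hDb) hlt
  obtain ⟨m, hm, hmb, hm'⟩ := exists_mem_Ioo_of_eventually_nhdsGT (eventually_besselD_pos hν) hb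
  obtain ⟨n, hmn, hnb, hn⟩ := exists_mem_Ioo_of_eventually_nhdsLT
    (eventually_nhdsLT_mul_neg (hasDerivAt_besselD hν.le hb) hDb hder.ne') hmb
  obtain ⟨c, hmc, hcn, hc⟩ := exists_zero_of_mul_neg hmn
    (fun y hy => continuousAt_besselD hν.le (hm.trans_le hy.1))
    (mul_neg_of_pos_of_neg hm' (neg_of_mul_neg_left hn hder.le))
  exact hD c (hm.trans hmc) (hcn.trans hnb) hc

theorem besselJ_zero_neg_of_first_zero (hb : 0 < b) (hDb : besselD 0 b = 0)
    (hD : ∀ x, 0 < x → x < b → besselD 0 x ≠ 0) : besselJ 0 b < 0 := by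
  have hne := besselJ_ne_zero_of_besselD_eq_zero le_rfl hb hDb
  by_contra hneg
  have hlt : 0 < besselJ 0 b := lt_of_le_of_ne (not_lt.1 hneg) hne.symm
  have hder := mul_neg_of_neg_of_pos (besselD_deriv_factor_neg le_rfl hb hDb) hlt
  obtain ⟨m, hm, hmb, hm'⟩ := exists_mem_Ioo_of_eventually_nhdsGT
    (eventually_besselJ_pos zero_le_one) hb
  have hDm : besselD 0 m < 0 := by
    rw [besselD, zero_mul, zero_sub, zero_add]
    exact neg_neg_of_pos (mul_pos hm hm')
  obtain ⟨n, hmn, hnb, hn⟩ := exists_mem_Ioo_of_eventually_nhdsLT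
    (eventually_nhdsLT_mul_neg (hasDerivAt_besselD le_rfl hb) hDb hder.ne) hmb
  obtain ⟨c, hmc, hcn, hc⟩ := exists_zero_of_mul_neg hmn
    (fun y hy => continuousAt_besselD le_rfl (hm.trans_le hy.1))
    (mul_neg_of_neg_of_pos hDm ((pos_iff_neg_of_mul_neg hn).2 hder))
  exact hD c (hm.trans hmc) (hcn.trans hnb) hc

theorem exists_besselD_left_zero_lt (hν : 0 < ν) (hνμ : ν < μ) (hμ : μ ≤ ν + 1) (hb : 0 < b)
    (hDb : besselD μ b = 0) (hD : ∀ x, 0 < x → x < b → besselD μ x ≠ 0) :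
    ∃ c, 0 < c ∧ c < b ∧ besselD ν c = 0 := by
  have hJ := besselJ_pos_of_first_zero (hν.trans hνμ) hb hDb hD
  have hW := besselW_pos hν.le hνμ hμ hb
  rw [besselW, hDb, mul_zero, zero_sub, neg_pos] at hW
  obtain ⟨m, hm, hmb, hm'⟩ := exists_mem_Ioo_of_eventually_nhdsGT (eventually_besselD_pos hν) hb
  obtain ⟨c, hmc, hcb, hc⟩ := exists_zero_of_mul_neg hmb
    (fun y hy => continuousAt_besselD hν.le (hm.trans_le hy.1))
    (mul_neg_of_pos_of_neg hm' (neg_of_mul_neg_left hW hJ.le))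
  exact ⟨c, hm.trans hmc, hcb, hc⟩

theorem exists_besselD_right_zero_lt (hμ0 : 0 < μ) (hμ : μ ≤ 1) (hb : 0 < b)
    (hDb : besselD 0 b = 0) (hD : ∀ x, 0 < x → x < b → besselD 0 x ≠ 0) :
    ∃ c, 0 < c ∧ c < b ∧ besselD μ c = 0 := by
  have hJ := besselJ_zero_neg_of_first_zero hb hDb hD
  have hW := besselW_pos le_rfl hμ0 (by simpa using hμ) hb
  rw [besselW, hDb, zero_mul, sub_zero] at hW
  obtain ⟨m, hm, hmb, hm'⟩ := exists_mem_Ioo_of_eventually_nhdsGT (eventually_besselD_pos hμ0) hb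
  obtain ⟨c, hmc, hcb, hc⟩ := exists_zero_of_mul_neg hmb
    (fun y hy => continuousAt_besselD hμ0.le (hm.trans_le hy.1))
    (mul_neg_of_pos_of_neg hm' ((neg_iff_neg_of_mul_pos hW).1 hJ))
  exact ⟨c, hm.trans hmc, hcb, hc⟩

/-- Two increasing sequences such that each has a term strictly between any two consecutive terms
of the other interlace, as soon as their first terms are in order. -/
theorem interlace_of_exists_between {a b : ℕ → ℝ} (ha : ∀ s t, 1 ≤ s → s < t → a s < a t)
    (hb : ∀ s t, 1 ≤ s → s < t → b s < b t) (h1 : a 1 < b 1)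
    (hab : ∀ s, 1 ≤ s → ∃ t, 1 ≤ t ∧ a s < b t ∧ b t < a (s + 1))
    (hba : ∀ s, 1 ≤ s → ∃ t, 1 ≤ t ∧ b s < a t ∧ a t < b (s + 1)) :
    ∀ s, 1 ≤ s → a s < b s ∧ b s < a (s + 1) := by
  have mono : ∀ {c : ℕ → ℝ}, (∀ s t, 1 ≤ s → s < t → c s < c t) →
      ∀ {s t}, 1 ≤ s → s ≤ t → c s ≤ c t := fun hc s t hs hst => by
    rcases hst.eq_or_lt with rfl | h
    · exact le_rfl
    · exact (hc s t hs h).le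
  have lt_of : ∀ {c : ℕ → ℝ}, (∀ s t, 1 ≤ s → s < t → c s < c t) →
      ∀ {s t}, 1 ≤ t → c s < c t → s < t := fun hc s t ht h => by
    by_contra hle
    exact absurd (mono hc ht (not_lt.1 hle)) (not_le.2 h)
  intro s hs
  induction s, hs using Nat.le_induction with
  | base =>
    obtain ⟨t, ht, -, hlt⟩ := hab 1 le_rfl
    exact ⟨h1, (mono hb le_rfl ht).trans_lt hlt⟩
  | succ s hs ih =>
    have h2 : a (s + 1) < b (s + 1) := by
      obtain ⟨t, ht, hlt, hlt'⟩ := hba s hs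
      exact (mono ha (by omega) (lt_of ha ht (ih.1.trans hlt))).trans_lt hlt'
    obtain ⟨t, ht, hlt, hlt'⟩ := hab (s + 1) (by omega)
    exact ⟨h2, (mono hb (by omega) (lt_of hb ht (ih.2.trans hlt))).trans_lt hlt'⟩

theorem interlace_of_pos {a b : ℕ → ℝ} (hν : 0 < ν) (hνμ : ν < μ) (hμ : μ ≤ ν + 1)
    (ha : IsPosZeroSeq (besselD ν) a) (hb : IsPosZeroSeq (besselD μ) b) :
    ∀ s, 1 ≤ s → a s < b s ∧ b s < a (s + 1) := by
  refine interlace_of_exists_between ha.mono hb.mono ?_ (fun s hs => ?_) (fun s hs => ?_)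
  · obtain ⟨c, hc, hcb, hDc⟩ := exists_besselD_left_zero_lt hν hνμ hμ (hb.pos 1 le_rfl)
      (hb.isZero 1 le_rfl) (fun x => hb.ne_zero_of_lt_first)
    obtain ⟨t, ht, rfl⟩ := ha.complete c hc hDc
    exact (ha.monotone le_rfl ht).trans_lt hcb
  · obtain ⟨c, hac, hca, hDc⟩ := exists_besselD_right_zero_between hν.le hνμ hμ (ha.pos s hs)
      (ha.mono s (s + 1) hs (by omega)) (ha.isZero s hs) (ha.isZero (s + 1) (by omega))
      (fun x => ha.ne_zero_between hs)
    obtain ⟨t, ht, rfl⟩ := hb.complete c ((ha.pos s hs).trans hac) hDc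
    exact ⟨t, ht, hac, hca⟩
  · obtain ⟨c, hbc, hcb, hDc⟩ := exists_besselD_left_zero_between hν.le hνμ hμ (hb.pos s hs)
      (hb.mono s (s + 1) hs (by omega)) (hb.isZero s hs) (hb.isZero (s + 1) (by omega))
      (fun x => hb.ne_zero_between hs)
    obtain ⟨t, ht, rfl⟩ := ha.complete c ((hb.pos s hs).trans hbc) hDc
    exact ⟨t, ht, hbc, hcb⟩

theorem interlace_of_zero {a b : ℕ → ℝ} (hμ0 : 0 < μ) (hμ : μ ≤ 1) (ha1 : a 1 = 0)
    (ha : IsPosZeroSeq (besselD 0) fun s => a (s + 1)) (hb : IsPosZeroSeq (besselD μ) b) :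
    ∀ s, 1 ≤ s → a s < b s ∧ b s < a (s + 1) := by
  have hμ' : μ ≤ 0 + 1 := by simpa using hμ
  refine interlace_of_exists_between (fun s t hs hst => ?_) hb.mono
    (ha1.trans_lt (hb.pos 1 le_rfl)) (fun s hs => ?_) (fun s hs => ?_)
  · obtain ⟨t, rfl⟩ : ∃ t', t = t' + 1 := ⟨t - 1, by omega⟩
    rcases hs.eq_or_lt with rfl | hs
    · exact ha1.trans_lt (ha.pos t (by omega))
    · obtain ⟨s, rfl⟩ : ∃ s', s = s' + 1 := ⟨s - 1, by omega⟩
      exact ha.mono s t (by omega) (by omega)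
  · rcases hs.eq_or_lt with rfl | hs
    · obtain ⟨c, hc, hca, hDc⟩ := exists_besselD_right_zero_lt hμ0 hμ (ha.pos 1 le_rfl)
        (ha.isZero 1 le_rfl) (fun x => ha.ne_zero_of_lt_first)
      obtain ⟨t, ht, rfl⟩ := hb.complete c hc hDc
      exact ⟨t, ht, ha1.trans_lt hc, hca⟩
    · obtain ⟨s, rfl⟩ : ∃ s', s = s' + 1 := ⟨s - 1, by omega⟩
      have hs : 1 ≤ s := by omega
      obtain ⟨c, hac, hca, hDc⟩ := exists_besselD_right_zero_between le_rfl hμ0 hμ' (ha.pos s hs)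
        (ha.mono s (s + 1) hs (by omega)) (ha.isZero s hs) (ha.isZero (s + 1) (by omega))
        (fun x => ha.ne_zero_between hs)
      obtain ⟨t, ht, rfl⟩ := hb.complete c ((ha.pos s hs).trans hac) hDc
      exact ⟨t, ht, hac, hca⟩
  · obtain ⟨c, hbc, hcb, hDc⟩ := exists_besselD_left_zero_between le_rfl hμ0 hμ' (hb.pos s hs)
      (hb.mono s (s + 1) hs (by omega)) (hb.isZero s hs) (hb.isZero (s + 1) (by omega))
      (fun x => hb.ne_zero_between hs)
    obtain ⟨t, ht, rfl⟩ := ha.complete c ((hb.pos s hs).trans hbc) hDc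
    exact ⟨t + 1, by omega, hbc, hcb⟩

end Zeros

/-- Interlacing of the zeros of `J'_ν` and `J'_{ν+ε}` for `0 < ε ≤ 1`:
`j'_{ν,s} < j'_{ν+ε,s} < j'_{ν,s+1}` for all `s ≥ 1`. -/
theorem besselJDeriv_zeros_interlace_eps (ν ε : ℝ) (hν : 0 ≤ ν)
    (hε : 0 < ε) (hε1 : ε ≤ 1)
    (j' jε' : ℕ → ℝ)
    (hj' : IsBesselJDerivZeroSeq ν j')
    (hjε' : IsBesselJDerivZeroSeq (ν + ε) jε') :
    ∀ s : ℕ, 1 ≤ s → j' s < jε' s ∧ jε' s < j' (s + 1) := by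
  have hμ : 0 < ν + ε := by positivity
  have hb := isPosZeroSeq_besselD hμ.le (hjε'.2 hμ.ne')
  rcases hν.eq_or_lt with rfl | hν
  · obtain ⟨h1, ha⟩ := hj'.1 rfl
    exact interlace_of_zero hμ (by simpa using hε1) h1
      (ha.congr fun _ hx => deriv_besselJ_eq_zero_iff le_rfl hx) hb
  · exact interlace_of_pos hν (by linarith) (by linarith)
      (isPosZeroSeq_besselD hν.le (hj'.2 hν.ne')) hb
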